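/- arXiv:1305.1366 — 4 statements merged into one kernel-verified Lean document; each statement's English description precedes it below -/
import Mathlib

section
/- Let n ≥ 11 and f ∈ ℤ/nℤ. If S is a Type III set for P_f(n,2) whose couple number is minimal among all Type III sets, then |S| ≥ ⌈3n/5⌉. -/
namespace PetersenDom

/-- Vertex set of the generalized Petersen graph: `Sum.inl i` is the outer
vertex `u_i`, `Sum.inr i` is the inner vertex `v_i`, indices in `ZMod n`. -/
abbrev PVert (n : ℕ) := ZMod n ⊕ ZMod n

/-- The outer vertex `u_i`. -/
def uV {n : ℕ} (i : ZMod n) : PVert n := Sum.inl i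

/-- The inner vertex `v_i`. -/
def vV {n : ℕ} (i : ZMod n) : PVert n := Sum.inr i

/-- The generalized Petersen graph `P(n,2)`, with edges
`u_i u_{i+1}`, `u_i v_i`, `v_i v_{i+2}` (indices mod `n`). -/
def P2 (n : ℕ) : SimpleGraph (PVert n) :=
  SimpleGraph.fromRel (fun a b =>
    (∃ i : ZMod n, a = uV i ∧ b = uV (i + 1)) ∨
    (∃ i : ZMod n, a = uV i ∧ b = vV i) ∨
    (∃ i : ZMod n, a = vV i ∧ b = vV (i + 2)))

/-- `S` is a dominating set of `G`: every vertex is in `S` or adjacent to a vertex of `S`. -/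
def IsDomSet {V : Type*} (G : SimpleGraph V) (S : Set V) : Prop :=
  ∀ v : V, v ∈ S ∨ ∃ u ∈ S, G.Adj u v

/-- The domination number of `G`. -/
noncomputable def domNum {V : Type*} (G : SimpleGraph V) : ℕ :=
  sInf {k | ∃ S : Set V, IsDomSet G S ∧ S.ncard = k}

/-- `S` is a dominating set of `P_f(n,2) = P(n,2) - u_f`: it avoids `u_f`
and dominates every vertex other than `u_f`. -/
def IsDomSetF (n : ℕ) (f : ZMod n) (S : Set (PVert n)) : Prop :=
  uV f ∉ S ∧ ∀ v : PVert n, v ≠ uV f → v ∈ S ∨ ∃ u ∈ S, (P2 n).Adj u v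

/-- The domination number of `P_f(n,2)`. -/
noncomputable def domNumF (n : ℕ) (f : ZMod n) : ℕ :=
  sInf {k | ∃ S : Set (PVert n), IsDomSetF n f S ∧ S.ncard = k}

/-- `S` is a minimum dominating set of `P_f(n,2)`. -/
def MinDomF (n : ℕ) (f : ZMod n) (S : Set (PVert n)) : Prop :=
  IsDomSetF n f S ∧ S.ncard = domNumF n f

/-- The neighborhood `N(u_f) = {u_{f-1}, u_{f+1}, v_f}` of `u_f` in `P(n,2)`. -/
def Nbr (n : ℕ) (f : ZMod n) : Set (PVert n) := {uV (f - 1), uV (f + 1), vV f}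

/-- The block `B_i`: the 5 consecutive pairs of vertices centered at `u_i, v_i`. -/
def Blk (n : ℕ) (i : ZMod n) : Set (PVert n) :=
  {uV (i-2), uV (i-1), uV i, uV (i+1), uV (i+2),
   vV (i-2), vV (i-1), vV i, vV (i+1), vV (i+2)}

/-- `γ_i(S) = |B_i ∩ S|`. -/
noncomputable def gam (n : ℕ) (i : ZMod n) (S : Set (PVert n)) : ℕ :=
  (Blk n i ∩ S).ncard

/-- `L_i = {v_{i-1}, u_{i-2}, v_{i-2}}`. -/
def Lset (n : ℕ) (i : ZMod n) : Set (PVert n) := {vV (i-1), uV (i-2), vV (i-2)}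

/-- `R_i = {v_{i+1}, u_{i+2}, v_{i+2}}`. -/
def Rset (n : ℕ) (i : ZMod n) : Set (PVert n) := {vV (i+1), uV (i+2), vV (i+2)}

/-- `M_i = {u_{i-1}, v_i, u_{i+1}}`. -/
def Mset (n : ℕ) (i : ZMod n) : Set (PVert n) := {uV (i-1), vV i, uV (i+1)}

/-- `F = {f-2, f-1, f, f+1, f+2}`, the indices of the block `B_f`. -/
def Fset (n : ℕ) (f : ZMod n) : Set (ZMod n) := {f-2, f-1, f, f+1, f+2}

/-- A Type I set: a minimum dominating set `S` of `P_f(n,2)` with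
`γ_i(S) ≥ 2` for all `i`. -/
def TypeI (n : ℕ) (f : ZMod n) (S : Set (PVert n)) : Prop :=
  MinDomF n f S ∧ ∀ i : ZMod n, 2 ≤ gam n i S

/-- The couple number of `S`: the number of indices `i ∉ F` with `γ_i(S) = 2`. -/
noncomputable def coupleNum (n : ℕ) (f : ZMod n) (S : Set (PVert n)) : ℕ :=
  {i : ZMod n | gam n i S = 2 ∧ i ∉ Fset n f}.ncard

/-- A Type II set: a Type I set with `N(u_f) ∩ S = ∅`, `γ_f(S) = 3`, and
`B_f ∩ S = {u_{f-2}, v_{f+1}, v_{f+2}}`. -/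
def TypeII (n : ℕ) (f : ZMod n) (S : Set (PVert n)) : Prop :=
  TypeI n f S ∧ Nbr n f ∩ S = ∅ ∧ gam n f S = 3 ∧
    Blk n f ∩ S = {uV (f-2), vV (f+1), vV (f+2)}

/-- A Type III set: a Type I set with `N(u_f) ∩ S = ∅`, `γ_f(S) = 4`, and
`B_f ∩ S` one of four specified patterns. -/
def TypeIII (n : ℕ) (f : ZMod n) (S : Set (PVert n)) : Prop :=
  TypeI n f S ∧ Nbr n f ∩ S = ∅ ∧ gam n f S = 4 ∧
    (Blk n f ∩ S = {vV (f-1), vV (f+1), uV (f+2), vV (f+2)} ∨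
     Blk n f ∩ S = {uV (f-2), vV (f-2), uV (f+2), vV (f+2)} ∨
     Blk n f ∩ S = {vV (f-2), vV (f-1), vV (f+1), vV (f+2)} ∨
     Blk n f ∩ S = {uV (f-2), vV (f-2), vV (f+1), uV (f+2)})

/-- `⌈3n/5⌉`. -/
noncomputable def ceil35 (n : ℕ) : ℕ := ⌈(3 * (n : ℚ)) / 5⌉₊

/-- The bondage number of `G`: the least number of edges whose deletion
increases the domination number. -/
noncomputable def bondage {V : Type*} (G : SimpleGraph V) : ℕ :=
  sInf {k | ∃ E : Set (Sym2 V), E ⊆ G.edgeSet ∧ E.ncard = k ∧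
    domNum G < domNum (G.deleteEdges E)}

/-- The domination alteration number of `G`: the least number of vertices
whose removal changes the domination number. -/
noncomputable def alterNum {V : Type*} (G : SimpleGraph V) : ℕ :=
  sInf {k | ∃ A : Set V, A.ncard = k ∧ domNum (G.induce Aᶜ) ≠ domNum G}

end PetersenDom
namespace PetersenDom

/-- The surplus carried across a column of a dominating set, as a function of the membership of
`v_{j-2}`, `v_{j-1}`, `u_j`, `v_j`, `u_{j+1}`, `v_{j+1}`. It only depends on whether `v_j` and the
vertices of the column `j + 1` are chosen, or else dominated from the columns up to `j + 1`. -/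
def surplus (va vb uc vc ud vd : Bool) : ℤ :=
  if vc then
    match ud, vd, uc, vb with
    | true, true, _, _ => 11
    | true, false, _, _ => 8
    | false, true, _, _ => 7
    | false, false, true, true => 8
    | false, false, true, false => 7
    | false, false, false, true => 4
    | false, false, false, false => 3
  else if va || uc then
    match ud, vd, uc, vb with
    | true, true, _, _ => 10
    | true, false, _, _ => 6
    | false, true, _, _ => 6
    | false, false, true, true => 5
    | false, false, true, false => 3
    | false, false, false, true => 5
    | false, false, false, false => 2
  else
    match ud, vd, vb with
    | true, false, _ => 4
    | false, false, false => 0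
    | false, false, true => 4
    | _, true, _ => 5

/-- Passing from one column to the next, the surplus grows by at most five times the number of
chosen vertices of the new column minus three, provided `v_c` is dominated and `u_d` is either
dominated or a deleted vertex with one of the admissible surroundings. -/
lemma surplus_step (va vb uc vc ud vd ue ve : Bool) (hv : vc || uc || va || ve)
    (hu : (ud || uc || ue || vd) ||
      (!ud && !uc && !ue && !vd && ((vb && !vc) || (vc && ve)))) :
    surplus vb vc ud vd ue ve - surplus va vb uc vc ud vd ≤
      5 * ((if ue then 1 else 0) + (if ve then 1 else 0)) - 3 := by
  revert va vb uc vc ud vd ue ve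
  decide

lemma uV_dominated {n : ℕ} {S : Set (PVert n)} {j : ZMod n}
    (h : uV j ∈ S ∨ ∃ w ∈ S, (P2 n).Adj w (uV j)) :
    uV j ∈ S ∨ uV (j - 1) ∈ S ∨ uV (j + 1) ∈ S ∨ vV j ∈ S := by
  rcases h with h | ⟨w, hw, hadj⟩
  · exact Or.inl h
  · simp only [P2, SimpleGraph.fromRel_adj, uV, vV] at hadj hw ⊢
    rcases hadj with ⟨-, (⟨i, rfl, hi⟩ | ⟨i, rfl, hi⟩ | ⟨i, rfl, hi⟩) |
      (⟨i, hi, rfl⟩ | ⟨i, hi, rfl⟩ | ⟨i, hi, rfl⟩)⟩ <;> simp_all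

lemma vV_dominated {n : ℕ} {S : Set (PVert n)} {j : ZMod n}
    (h : vV j ∈ S ∨ ∃ w ∈ S, (P2 n).Adj w (vV j)) :
    vV j ∈ S ∨ uV j ∈ S ∨ vV (j - 2) ∈ S ∨ vV (j + 2) ∈ S := by
  rcases h with h | ⟨w, hw, hadj⟩
  · exact Or.inl h
  · simp only [P2, SimpleGraph.fromRel_adj, uV, vV] at hadj hw ⊢
    rcases hadj with ⟨-, (⟨i, rfl, hi⟩ | ⟨i, rfl, hi⟩ | ⟨i, rfl, hi⟩) |
      (⟨i, hi, rfl⟩ | ⟨i, hi, rfl⟩ | ⟨i, hi, rfl⟩)⟩ <;> simp_all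

open Classical in
lemma ncard_eq_sum_columns {n : ℕ} [NeZero n] (S : Set (PVert n)) :
    (S.ncard : ℤ) = ∑ i : ZMod n, ((if uV i ∈ S then 1 else 0) + (if vV i ∈ S then 1 else 0)) := by
  rw [Finset.sum_add_distrib, Set.ncard_eq_toFinset_card', Finset.card_eq_sum_ones,
    ← Set.filter_mem_univ_eq_toFinset, Finset.sum_filter, Fintype.sum_sum_type]
  push_cast
  rfl

/-- Around the deleted vertex, the inner vertices of a Type III set that matter. -/
lemma TypeIII.inner_pattern {n : ℕ} (hn : 11 ≤ n) {f : ZMod n} {S : Set (PVert n)}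
    (hS : TypeIII n f S) :
    (vV (f - 2) ∈ S ∧ vV (f - 1) ∉ S) ∨ (vV (f - 1) ∈ S ∧ vV (f + 1) ∈ S) := by
  have hk : ∀ k : ℕ, 0 < k → k < 11 → ((k : ℕ) : ZMod n) ≠ 0 := fun k h0 h11 h =>
    absurd (Nat.le_of_dvd h0 ((ZMod.natCast_eq_zero_iff k n).1 h)) (by omega)
  have hB : ∀ w ∈ Blk n f, (w ∈ S ↔ w ∈ Blk n f ∩ S) := fun w hw => by simp [hw]
  have h2 := hB (vV (f - 2)) (by simp [Blk])
  have h1 := hB (vV (f - 1)) (by simp [Blk])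
  have h1' := hB (vV (f + 1)) (by simp [Blk])
  have e1 : f - 1 ≠ f - 2 := fun h => hk 1 (by norm_num) (by norm_num) (by
    push_cast; linear_combination h)
  have e2 : f - 1 ≠ f + 2 := fun h => hk 3 (by norm_num) (by norm_num) (by
    push_cast; linear_combination -h)
  have e3 : f - 1 ≠ f + 1 := fun h => hk 2 (by norm_num) (by norm_num) (by
    push_cast; linear_combination -h)
  rw [h2, h1, h1']
  obtain ⟨-, -, -, h | h | h | h⟩ := hS <;> rw [h] <;> simp [uV, vV, e1, e2, e3]

open Classical in
/-- The surplus of a vertex set at the column `j + 1`. -/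
noncomputable def surplusAt {n : ℕ} (S : Set (PVert n)) (j : ZMod n) : ℤ :=
  surplus (vV (j - 2) ∈ S) (vV (j - 1) ∈ S) (uV j ∈ S) (vV j ∈ S) (uV (j + 1) ∈ S) (vV (j + 1) ∈ S)

open Classical in
lemma TypeIII.surplusAt_step {n : ℕ} (hn : 11 ≤ n) {f : ZMod n} {S : Set (PVert n)}
    (hS : TypeIII n f S) (j : ZMod n) :
    surplusAt S (j + 1) - surplusAt S j ≤
      5 * ((if uV (j + 2) ∈ S then 1 else 0) + (if vV (j + 2) ∈ S then 1 else 0)) - 3 := by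
  have hdom := hS.1.1.1
  have hv := vV_dominated (hdom.2 (vV j) (by simp [uV, vV]))
  have hu : (uV (j + 1) ∈ S ∨ uV j ∈ S ∨ uV (j + 2) ∈ S ∨ vV (j + 1) ∈ S) ∨
      (uV (j + 1) ∉ S ∧ uV j ∉ S ∧ uV (j + 2) ∉ S ∧ vV (j + 1) ∉ S ∧
        ((vV (j - 1) ∈ S ∧ vV j ∉ S) ∨ (vV j ∈ S ∧ vV (j + 2) ∈ S))) := by
    have a1 : j + 1 - 1 = j := by ring
    have a2 : j + 1 + 1 = j + 2 := by ring
    have a3 : j + 1 - 2 = j - 1 := by ring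
    by_cases hf : uV (j + 1) = uV f
    · obtain rfl : j + 1 = f := Sum.inl_injective hf
      have hp := hS.inner_pattern hn
      have hN : ∀ w ∈ Nbr n (j + 1), w ∉ S := fun w hw hwS =>
        Set.notMem_empty w (hS.2.1 ▸ ⟨hw, hwS⟩)
      simp only [Nbr, Set.mem_insert_iff, Set.mem_singleton_iff, forall_eq_or_imp, forall_eq,
        a1, a2] at hN
      rw [a1, a2, a3] at hp
      exact Or.inr ⟨hdom.1, hN.1, hN.2.1, hN.2.2, hp⟩
    · have h := uV_dominated (hdom.2 _ hf)
      rw [a1, a2] at h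
      exact Or.inl h
  have key := surplus_step (vV (j - 2) ∈ S) (vV (j - 1) ∈ S) (uV j ∈ S) (vV j ∈ S)
    (uV (j + 1) ∈ S) (vV (j + 1) ∈ S) (uV (j + 2) ∈ S) (vV (j + 2) ∈ S)
    (by simpa [or_assoc] using hv) (by simpa [or_assoc, and_assoc] using hu)
  have b1 : j + 1 - 2 = j - 1 := by ring
  have b2 : j + 1 - 1 = j := by ring
  have b3 : j + 1 + 1 = j + 2 := by ring
  simpa only [surplusAt, b1, b2, b3, decide_eq_true_eq] using key

/-- A Type III set has at least `3n/5` vertices, whatever its couple number. -/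
lemma TypeIII.three_mul_le {n : ℕ} (hn : 11 ≤ n) {f : ZMod n} {S : Set (PVert n)}
    (hS : TypeIII n f S) : 3 * n ≤ 5 * S.ncard := by
  classical
  have : NeZero n := ⟨by omega⟩
  have h := Finset.sum_le_sum fun j (_ : j ∈ (Finset.univ : Finset (ZMod n))) =>
    hS.surplusAt_step hn j
  rw [Finset.sum_sub_distrib, Finset.sum_sub_distrib, ← Finset.mul_sum,
    Fintype.sum_equiv (Equiv.addRight (1 : ZMod n)) (fun j => surplusAt S (j + 1)) (surplusAt S)
      fun _ => rfl,
    Fintype.sum_equiv (Equiv.addRight (2 : ZMod n))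
      (fun j => (if uV (j + 2) ∈ S then (1 : ℤ) else 0) + (if vV (j + 2) ∈ S then 1 else 0))
      (fun j => (if uV j ∈ S then (1 : ℤ) else 0) + (if vV j ∈ S then 1 else 0)) fun _ => rfl,
    ← ncard_eq_sum_columns, Finset.sum_const, Finset.card_univ, ZMod.card, nsmul_eq_mul] at h
  lia

/-- a Type III set of minimal couple number among Type III sets
has cardinality at least `⌈3n/5⌉`. -/
theorem typeIII_lower_bound (n : ℕ) (hn : 11 ≤ n) (f : ZMod n)
    (S : Set (PVert n)) (hS : TypeIII n f S)
    (hmin : ∀ T : Set (PVert n), TypeIII n f T → coupleNum n f S ≤ coupleNum n f T) :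
    ceil35 n ≤ S.ncard := by
  have h : (3 * n : ℚ) ≤ 5 * S.ncard := by exact_mod_cast hS.three_mul_le hn
  exact Nat.ceil_le.2 (by linarith)

end PetersenDom
end

section
/- Let n ≥ 10, let S be a set of vertices of P(n,2), and let i ∈ ℤ/nℤ. If both B_i and B_{i−5} are self-contained blocks with respect to S, i.e., B_i ∩ S = {u_{i−2}, v_i, v_{i+1}} and B_{i−5} ∩ S = {u_{i−7}, v_{i−5}, v_{i−4}}, then γ_x(S) = 3 for every x ∈ {i−5, i−4, i−3, i−2, i−1, i}. -/
namespace PetersenDom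

/-- Small nonzero naturals stay nonzero in `ZMod n`. -/
lemma natCast_zmod_ne_zero {n k : ℕ} (hk : 0 < k) (hkn : k < n) : (k : ZMod n) ≠ 0 := by
  rw [Ne, ZMod.natCast_eq_zero_iff]
  exact Nat.not_dvd_of_pos_of_lt hk hkn

/-- The four consecutive pairs of vertices shared by the blocks `B_x` and `B_{x+1}`. -/
def blkOverlap (n : ℕ) (x : ZMod n) : Set (PVert n) :=
  {uV (x-1), uV x, uV (x+1), uV (x+2), vV (x-1), vV x, vV (x+1), vV (x+2)}

lemma Blk_eq_insert_blkOverlap (n : ℕ) (x : ZMod n) :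
    Blk n x = insert (uV (x-2)) (insert (vV (x-2)) (blkOverlap n x)) := by
  ext e
  simp only [Blk, blkOverlap, Set.mem_insert_iff, Set.mem_singleton_iff]
  tauto

lemma Blk_add_one_eq_insert_blkOverlap (n : ℕ) (x : ZMod n) :
    Blk n (x+1) = insert (uV (x+3)) (insert (vV (x+3)) (blkOverlap n x)) := by
  ext e
  have e1 : x + 1 - 2 = x - 1 := by ring
  have e2 : x + 1 - 1 = x := by ring
  have e3 : x + 1 + 1 = x + 2 := by ring
  have e4 : x + 1 + 2 = x + 3 := by ring
  simp only [Blk, blkOverlap, Set.mem_insert_iff, Set.mem_singleton_iff, e1, e2, e3, e4]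
  tauto

lemma ncard_insert_insert_inter_congr {V : Type*} {S T : Set V} (hT : T.Finite) {a b c d : V}
    (hab : a ≠ b) (hcd : c ≠ d) (ha : a ∉ T) (hb : b ∉ T) (hc : c ∉ T) (hd : d ∉ T)
    (hac : a ∈ S ↔ c ∈ S) (hbd : b ∈ S ↔ d ∈ S) :
    (insert a (insert b T) ∩ S).ncard = (insert c (insert d T) ∩ S).ncard := by
  have hf : (T ∩ S).Finite := hT.inter_of_left S
  by_cases h : c ∈ S <;> by_cases h' : d ∈ S <;>
    simp [Set.insert_inter_of_mem, Set.insert_inter_of_notMem, Set.ncard_insert_of_notMem,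
      hf.insert, *]

/-- Translating a block by one keeps `γ` if the pair that leaves and the pair that enters
meet `S` in the same way. -/
lemma gam_add_one {n : ℕ} (hn : 6 ≤ n) (S : Set (PVert n)) (x : ZMod n)
    (hu : uV (x-2) ∈ S ↔ uV (x+3) ∈ S) (hv : vV (x-2) ∈ S ↔ vV (x+3) ∈ S) :
    gam n (x+1) S = gam n x S := by
  have h1 : (1 : ZMod n) ≠ 0 := by
    exact_mod_cast natCast_zmod_ne_zero (n := n) (k := 1) (by omega) (by omega)
  have h2 : (2 : ZMod n) ≠ 0 := by
    exact_mod_cast natCast_zmod_ne_zero (n := n) (k := 2) (by omega) (by omega)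
  have h3 : (3 : ZMod n) ≠ 0 := by
    exact_mod_cast natCast_zmod_ne_zero (n := n) (k := 3) (by omega) (by omega)
  have h4 : (4 : ZMod n) ≠ 0 := by
    exact_mod_cast natCast_zmod_ne_zero (n := n) (k := 4) (by omega) (by omega)
  have left1 : x - 2 ≠ x - 1 := fun h => h1 (by linear_combination -h)
  have left2 : x - 2 ≠ x := fun h => h2 (by linear_combination -h)
  have left3 : x - 2 ≠ x + 1 := fun h => h3 (by linear_combination -h)
  have left4 : x - 2 ≠ x + 2 := fun h => h4 (by linear_combination -h)
  have right1 : x + 3 ≠ x - 1 := fun h => h4 (by linear_combination h)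
  have right2 : x + 3 ≠ x := fun h => h3 (by linear_combination h)
  have right3 : x + 3 ≠ x + 1 := fun h => h2 (by linear_combination h)
  have right4 : x + 3 ≠ x + 2 := fun h => h1 (by linear_combination h)
  rw [gam, gam, Blk_add_one_eq_insert_blkOverlap, Blk_eq_insert_blkOverlap]
  symm
  apply ncard_insert_insert_inter_congr _ _ _ _ _ _ _ hu hv
  · simp [blkOverlap]
  all_goals
    simp only [blkOverlap, uV, vV, Set.mem_insert_iff, Set.mem_singleton_iff, Sum.inl.injEq,
      Sum.inr.injEq, reduceCtorEq, ne_eq, not_false_eq_true, left1, left2, left3, left4,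
      right1, right2, right3, right4, or_self]

/-- if both `B_i` and `B_{i-5}` are self-contained blocks with
respect to `S`, then `γ_x(S) = 3` for every `x ∈ {i-5, ..., i}`. -/
theorem selfContained_gam_eq_three (n : ℕ) (hn : 10 ≤ n) (S : Set (PVert n))
    (i : ZMod n)
    (h1 : Blk n i ∩ S = {uV (i-2), vV i, vV (i+1)})
    (h2 : Blk n (i-5) ∩ S = {uV (i-7), vV (i-5), vV (i-4)}) :
    ∀ x ∈ ({i-5, i-4, i-3, i-2, i-1, i} : Set (ZMod n)), gam n x S = 3 := by
  have mem1 : ∀ e ∈ Blk n i, (e ∈ S ↔ e ∈ ({uV (i-2), vV i, vV (i+1)} : Set (PVert n))) :=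
    fun e he => by rw [← h1]; exact ⟨fun h => ⟨he, h⟩, fun h => h.2⟩
  have mem2 : ∀ e ∈ Blk n (i-5),
      (e ∈ S ↔ e ∈ ({uV (i-7), vV (i-5), vV (i-4)} : Set (PVert n))) :=
    fun e he => by rw [← h2]; exact ⟨fun h => ⟨he, h⟩, fun h => h.2⟩
  have hu : ∀ y z : ZMod n, z = y + 5 → uV y ∈ Blk n (i-5) → uV z ∈ Blk n i →
      (uV y ∈ S ↔ uV z ∈ S) := by
    rintro y z rfl hy hz
    rw [mem1 _ hz, mem2 _ hy]
    simp only [uV, vV, Set.mem_insert_iff, Set.mem_singleton_iff, Sum.inl.injEq, reduceCtorEq,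
      or_false]
    constructor <;> intro h <;> linear_combination h
  have hv : ∀ y z : ZMod n, z = y + 5 → vV y ∈ Blk n (i-5) → vV z ∈ Blk n i →
      (vV y ∈ S ↔ vV z ∈ S) := by
    rintro y z rfl hy hz
    rw [mem1 _ hz, mem2 _ hy]
    simp only [uV, vV, Set.mem_insert_iff, Set.mem_singleton_iff, Sum.inr.injEq, reduceCtorEq,
      false_or]
    refine or_congr ?_ ?_ <;> constructor <;> intro h <;> linear_combination h
  have slide : ∀ y ∈ ({i-5, i-4, i-3, i-2, i-1} : Set (ZMod n)),
      gam n (y+1) S = gam n y S := by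
    intro y hy
    have block1 : y + 3 ∈ ({i-2, i-1, i, i+1, i+2} : Set (ZMod n)) := by
      rcases hy with rfl | rfl | rfl | rfl | rfl <;> ring_nf <;> simp
    have block2 : y - 2 ∈ ({i-5-2, i-5-1, i-5, i-5+1, i-5+2} : Set (ZMod n)) := by
      rcases hy with rfl | rfl | rfl | rfl | rfl <;> ring_nf <;> simp
    simp only [Set.mem_insert_iff, Set.mem_singleton_iff] at block1 block2
    apply gam_add_one (by omega)
    · apply hu _ _ (by ring) <;> simpa only [Blk, uV, vV, Set.mem_insert_iff,
        Set.mem_singleton_iff, Sum.inl.injEq, reduceCtorEq, or_false, false_or]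
    · apply hv _ _ (by ring) <;> simpa only [Blk, uV, vV, Set.mem_insert_iff,
        Set.mem_singleton_iff, Sum.inr.injEq, reduceCtorEq, or_false, false_or]
  have g0 : gam n i S = 3 := by
    have hne : (1 : ZMod n) ≠ 0 := by
      exact_mod_cast natCast_zmod_ne_zero (n := n) (k := 1) (by omega) (by omega)
    rw [gam, h1, Set.ncard_eq_three]
    exact ⟨_, _, _, by simp [uV, vV], by simp [uV, vV], by simpa [vV] using hne, rfl⟩
  have step : ∀ y z : ZMod n, z = y + 1 → y ∈ ({i-5, i-4, i-3, i-2, i-1} : Set (ZMod n)) →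
      gam n z S = 3 → gam n y S = 3 := by
    rintro y z rfl hy hz
    rw [← slide y hy, hz]
  have g1 : gam n (i-1) S = 3 := step _ _ (by ring) (by simp) g0
  have g2 : gam n (i-2) S = 3 := step _ _ (by ring) (by simp) g1
  have g3 : gam n (i-3) S = 3 := step _ _ (by ring) (by simp) g2
  have g4 : gam n (i-4) S = 3 := step _ _ (by ring) (by simp) g3
  have g5 : gam n (i-5) S = 3 := step _ _ (by ring) (by simp) g4
  rintro x (rfl | rfl | rfl | rfl | rfl | rfl) <;> assumption

end PetersenDom
end

section
/- Let n ≥ 11 with n ≡ 4 (mod 5), and let f ∈ ℤ/nℤ. If S is a Type II set for P_f(n,2) and at least two of the three quantities γ_{f−2}(S), γ_{f−1}(S), γ_{f+1}(S) are greater than 2, then |S| ≥ ⌈3n/5⌉. -/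
namespace PetersenDom

/-- The possible traces of a vertex set on a column `{u_i, v_i}`. -/
inductive Trace
  | none | outer | inner | both
  deriving DecidableEq

namespace Trace

instance : Fintype Trace where
  elems := {none, outer, inner, both}
  complete a := by cases a <;> decide

/-- Whether the trace contains the outer vertex. -/
def hasOuter : Trace → Bool
  | outer | both => true
  | _ => false

/-- Whether the trace contains the inner vertex. -/
def hasInner : Trace → Bool
  | inner | both => true
  | _ => false

/-- The number of vertices in the trace. -/
def size (a : Trace) : ℕ := a.hasOuter.toNat + a.hasInner.toNat

/-- Both vertices of the middle one of five consecutive columns are dominated. -/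
def Dominates (a b c d e : Trace) : Prop :=
  (c.hasOuter || c.hasInner || b.hasOuter || d.hasOuter) = true ∧
    (c.hasInner || c.hasOuter || a.hasInner || e.hasInner) = true

instance (a b c d e : Trace) : Decidable (Dominates a b c d e) :=
  inferInstanceAs (Decidable (_ ∧ _))

/-- The nonlinear part of `potential`. -/
def correction : Trace → Trace → Trace → Trace → ℤ
  | .none, .none, .none, .outer => 2
  | .none, .none, .outer, .none => 1
  | .none, .none, .outer, .outer => 2
  | .none, .none, .inner, .none => 2
  | .none, .none, .inner, .outer => 2
  | .none, .none, .inner, .inner => 2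
  | .none, .none, .both, .none => 1
  | .none, .outer, .none, .none => -1
  | .none, .outer, .inner, .none => -1
  | .none, .inner, .none, .none => -1
  | .none, .inner, .outer, .none => 1
  | .outer, .none, .none, .none => -1
  | .outer, .none, .none, .inner => -2
  | .outer, .none, .none, .both => -1
  | .outer, .none, .inner, .outer => 1
  | .outer, .outer, .none, .none => -1
  | .outer, .inner, .none, .none => -2
  | .outer, .inner, .none, .outer => -1
  | .outer, .inner, .none, .inner => -1
  | .inner, .none, .none, .outer => 2
  | .inner, .none, .none, .both => 2
  | .inner, .none, .inner, .outer => 2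
  | .inner, .inner, .none, .none => -1
  | .both, .none, .none, .outer => 1
  | _, _, _, _ => 0

/-- A potential on four consecutive columns. Moving on by one column past a dominated column
increases it by at most `5 |S ∩ column| - 3`. -/
def potential (a b c d : Trace) : ℤ :=
  a.size + 2 * b.size + 3 * c.size + 4 * d.size + correction a b c d

theorem potential_step : ∀ a b c d e : Trace, Dominates a b c d e →
    potential b c d e ≤ potential a b c d + (5 * e.size - 3) := by
  decide +kernel

theorem potential_le_sum (x : ℕ → Trace) (m : ℕ)
    (h : ∀ k < m, Dominates (x k) (x (k + 1)) (x (k + 2)) (x (k + 3)) (x (k + 4))) :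
    potential (x m) (x (m + 1)) (x (m + 2)) (x (m + 3)) ≤
      potential (x 0) (x 1) (x 2) (x 3) + ∑ k ∈ Finset.range m, (5 * (x (k + 4)).size - 3 : ℤ) := by
  induction m with
  | zero => simp
  | succ m ih =>
    rw [Finset.sum_range_succ]
    have := ih fun k hk => h k (by omega)
    have := potential_step _ _ _ _ _ (h m (by omega))
    simp only [add_assoc, Nat.reduceAdd, Nat.add_comm 1] at *
    linarith

/-- The columns `p, q, r, s` come just before the block `outer, none, none, inner, inner`, and
the column `t` just after it. -/
theorem neg_one_le_closing : ∀ p q r s t : Trace,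
    Dominates p q r s outer → Dominates q r s outer none → Dominates r s outer none none →
    Dominates s outer none none inner → Dominates none none inner inner t →
    ((1 < r.size + s.size ∧ 0 < s.size) ∨ (1 < r.size + s.size ∧ 0 < t.size) ∨
      (0 < s.size ∧ 0 < t.size)) →
    -1 ≤ (5 * t.size : ℤ) - 3 + (potential p q r s - potential none inner inner t) := by
  decide +kernel

end Trace

variable {n : ℕ}

open Classical in
/-- The trace of `S` on the column `{u_i, v_i}`. -/
noncomputable def trace (S : Set (PVert n)) (i : ZMod n) : Trace :=
  if uV i ∈ S then (if vV i ∈ S then .both else .outer)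
  else (if vV i ∈ S then .inner else .none)

theorem hasOuter_trace (S : Set (PVert n)) (i : ZMod n) :
    (trace S i).hasOuter = true ↔ uV i ∈ S := by
  unfold trace; split_ifs <;> simp_all [Trace.hasOuter]

theorem hasInner_trace (S : Set (PVert n)) (i : ZMod n) :
    (trace S i).hasInner = true ↔ vV i ∈ S := by
  unfold trace; split_ifs <;> simp_all [Trace.hasInner]

open Classical in
theorem size_trace (S : Set (PVert n)) (i : ZMod n) :
    (trace S i).size = (if uV i ∈ S then 1 else 0) + (if vV i ∈ S then 1 else 0) := by
  unfold trace; split_ifs <;> rfl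

theorem ncard_eq_sum_size_trace [NeZero n] (S : Set (PVert n)) :
    S.ncard = ∑ i, (trace S i).size := by
  classical
  rw [Set.ncard_eq_toFinset_card']
  simp only [size_trace, Finset.sum_add_distrib]
  refine Eq.trans ?_ (Fintype.sum_sum_type fun p : PVert n => if p ∈ S then 1 else 0)
  rw [Finset.sum_boole, Set.filter_mem_univ_eq_toFinset, Nat.cast_id]

theorem sum_range_add_natCast [NeZero n] (F : ZMod n → ℤ) (g : ZMod n) :
    ∑ k ∈ Finset.range n, F (g + k) = ∑ i, F i := by
  rw [← Equiv.sum_comp (Equiv.addLeft g)]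
  refine Finset.sum_nbij' (fun k => (k : ZMod n)) ZMod.val ?_ ?_ ?_ ?_ ?_
  · simp
  · simp [ZMod.val_lt]
  · intro k hk
    exact ZMod.val_natCast_of_lt (Finset.mem_range.mp hk)
  · simp
  · simp

theorem ncard_column_le (S : Set (PVert n)) (i : ZMod n) :
    (({uV i, vV i} : Set (PVert n)) ∩ S).ncard ≤ (trace S i).size := by
  classical
  rw [size_trace]
  by_cases hu : uV i ∈ S <;> by_cases hv : vV i ∈ S <;>
    simp only [Set.insert_inter_of_mem, Set.insert_inter_of_notMem, Set.singleton_inter_of_mem,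
      Set.singleton_inter_eq_empty.mpr, hu, hv, not_false_eq_true, if_true, if_false]
  · exact Set.ncard_insert_le _ _ |>.trans (by simp)
  all_goals simp

theorem gam_le_sum_size_trace (S : Set (PVert n)) (i : ZMod n) :
    gam n i S ≤ (trace S (i - 2)).size + (trace S (i - 1)).size + (trace S i).size +
      (trace S (i + 1)).size + (trace S (i + 2)).size := by
  have hB : Blk n i ∩ S = {uV (i - 2), vV (i - 2)} ∩ S ∪ {uV (i - 1), vV (i - 1)} ∩ S ∪
      {uV i, vV i} ∩ S ∪ {uV (i + 1), vV (i + 1)} ∩ S ∪ {uV (i + 2), vV (i + 2)} ∩ S := by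
    ext p
    simp only [Blk, Set.mem_inter_iff, Set.mem_union, Set.mem_insert_iff, Set.mem_singleton_iff]
    tauto
  rw [gam, hB]
  refine (Set.ncard_union_le _ _).trans (add_le_add ?_ (ncard_column_le S _))
  refine (Set.ncard_union_le _ _).trans (add_le_add ?_ (ncard_column_le S _))
  refine (Set.ncard_union_le _ _).trans (add_le_add ?_ (ncard_column_le S _))
  exact (Set.ncard_union_le _ _).trans (add_le_add (ncard_column_le S _) (ncard_column_le S _))

theorem dominates_trace {f : ZMod n} {S : Set (PVert n)} (hS : IsDomSetF n f S) {i : ZMod n}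
    (hi : i ≠ f) :
    Trace.Dominates (trace S (i - 2)) (trace S (i - 1)) (trace S i) (trace S (i + 1))
      (trace S (i + 2)) := by
  simp only [Trace.Dominates, Bool.or_eq_true, hasOuter_trace, hasInner_trace]
  constructor
  · rcases hS.2 (uV i) (by simpa [uV] using hi) with h | ⟨p, hp, hadj⟩
    · tauto
    · rw [P2, SimpleGraph.fromRel_adj] at hadj
      rcases hadj.2 with (⟨j, rfl, hj⟩ | ⟨j, rfl, hj⟩ | ⟨j, rfl, hj⟩) |
        (⟨j, hj, rfl⟩ | ⟨j, hj, rfl⟩ | ⟨j, hj, rfl⟩) <;>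
        simp only [uV, vV, Sum.inl.injEq, reduceCtorEq] at hj <;> subst hj <;> simp_all [uV, vV]
  · rcases hS.2 (vV i) (by simp [uV, vV]) with h | ⟨p, hp, hadj⟩
    · tauto
    · rw [P2, SimpleGraph.fromRel_adj] at hadj
      rcases hadj.2 with (⟨j, rfl, hj⟩ | ⟨j, rfl, hj⟩ | ⟨j, rfl, hj⟩) |
        (⟨j, hj, rfl⟩ | ⟨j, hj, rfl⟩ | ⟨j, hj, rfl⟩) <;>
        simp only [uV, vV, Sum.inr.injEq, reduceCtorEq] at hj <;> subst hj <;> simp_all [uV, vV]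

theorem natCast_ne_zero_of_lt {k : ℕ} (h0 : 0 < k) (hk : k < n) : (k : ZMod n) ≠ 0 := fun h =>
  absurd (Nat.le_of_dvd h0 ((ZMod.natCast_eq_zero_iff k n).mp h)) (by omega)

theorem traces_of_blk_inter_eq (hn : 5 ≤ n) {f : ZMod n} {S : Set (PVert n)}
    (hB : Blk n f ∩ S = {uV (f - 2), vV (f + 1), vV (f + 2)}) :
    trace S (f - 2) = .outer ∧ trace S (f - 1) = .none ∧ trace S f = .none ∧
      trace S (f + 1) = .inner ∧ trace S (f + 2) = .inner := by
  have ne {a b : ZMod n} (k : ℕ) (h0 : 0 < k) (hk : k < 5) (h : a - b = k) : a ≠ b := by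
    rintro rfl
    exact natCast_ne_zero_of_lt h0 (hk.trans_le hn) (by simpa using h.symm)
  have e1 : f - 1 ≠ f - 2 := ne 1 (by omega) (by omega) (by push_cast; ring)
  have e2 : f ≠ f - 2 := ne 2 (by omega) (by omega) (by push_cast; ring)
  have e3 : f + 1 ≠ f - 2 := ne 3 (by omega) (by omega) (by push_cast; ring)
  have e4 : f + 2 ≠ f - 2 := ne 4 (by omega) (by omega) (by push_cast; ring)
  have e5 : f + 1 ≠ f - 1 := ne 2 (by omega) (by omega) (by push_cast; ring)
  have e6 : f + 2 ≠ f - 1 := ne 3 (by omega) (by omega) (by push_cast; ring)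
  have e7 : f + 1 ≠ f := ne 1 (by omega) (by omega) (by push_cast; ring)
  have e8 : f + 2 ≠ f := ne 2 (by omega) (by omega) (by push_cast; ring)
  have mem (p : PVert n) (hp : p ∈ Blk n f) :
      p ∈ S ↔ p = uV (f - 2) ∨ p = vV (f + 1) ∨ p = vV (f + 2) := by
    have := Set.ext_iff.mp hB p
    simpa [hp] using this
  have hu (j : ZMod n) (hj : j = f - 2 ∨ j = f - 1 ∨ j = f ∨ j = f + 1 ∨ j = f + 2) :
      uV j ∈ S ↔ j = f - 2 := by
    rw [mem _ (by rcases hj with rfl | rfl | rfl | rfl | rfl <;> simp [Blk])]; simp [uV, vV]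
  have hv (j : ZMod n) (hj : j = f - 2 ∨ j = f - 1 ∨ j = f ∨ j = f + 1 ∨ j = f + 2) :
      vV j ∈ S ↔ j = f + 1 ∨ j = f + 2 := by
    rw [mem _ (by rcases hj with rfl | rfl | rfl | rfl | rfl <;> simp [Blk])]; simp [uV, vV]
  refine ⟨?_, ?_, ?_, ?_, ?_⟩ <;>
    simp only [trace, hu, hv, true_or, or_true, if_true, if_false, or_self, e1, e2, e3, e4,
      e3.symm, e4.symm, e5.symm, e6.symm, e7.symm, e8.symm]

/-- for `n ≡ 4 (mod 5)`, a Type II set with at least two of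
`γ_{f-2}, γ_{f-1}, γ_{f+1}` greater than 2 has cardinality at least `⌈3n/5⌉`. -/
theorem typeII_lower_bound_mod4_two_large (n : ℕ) (hn : 11 ≤ n)
    (hmod : n % 5 = 4) (f : ZMod n) (S : Set (PVert n)) (hS : TypeII n f S)
    (h2 : (2 < gam n (f-2) S ∧ 2 < gam n (f-1) S) ∨
          (2 < gam n (f-2) S ∧ 2 < gam n (f+1) S) ∨
          (2 < gam n (f-1) S ∧ 2 < gam n (f+1) S)) :
    ceil35 n ≤ S.ncard := by
  have : NeZero n := ⟨by omega⟩
  obtain ⟨⟨⟨hdom, -⟩, -⟩, -, -, hB⟩ := hS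
  obtain ⟨t0, t1, t2, t3, t4⟩ := traces_of_blk_inter_eq (by omega) hB
  obtain ⟨m, rfl⟩ : ∃ m, n = 6 + m := ⟨n - 6, by omega⟩
  have hcast : (m : ZMod (6 + m)) = -6 := by
    have := ZMod.natCast_self (6 + m)
    push_cast at this
    linear_combination this
  have dominates (i : ZMod (6 + m)) (k : ℕ) (h0 : 0 < k) (hk : k < 6 + m) (hi : i = f + k) :=
    dominates_trace hdom (i := i) (by simpa [hi] using natCast_ne_zero_of_lt h0 hk)
  have hchain := Trace.potential_le_sum (fun k => trace S (f + k)) m fun k hk => by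
    have := dominates (f + (k + 2)) (k + 2) (by omega) (by omega) (by push_cast; ring)
    push_cast
    convert this using 2 <;> ring
  have hclose := Trace.neg_one_le_closing (trace S (f - 6)) (trace S (f - 5)) (trace S (f - 4))
    (trace S (f - 3)) (trace S (f + 3))
  have d1 := dominates (f - 4) (m + 2) (by omega) (by omega) (by push_cast; rw [hcast]; ring)
  have d2 := dominates (f - 3) (m + 3) (by omega) (by omega) (by push_cast; rw [hcast]; ring)
  have d3 := dominates (f - 2) (m + 4) (by omega) (by omega) (by push_cast; rw [hcast]; ring)
  have d4 := dominates (f - 1) (m + 5) (by omega) (by omega) (by push_cast; rw [hcast]; ring)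
  have d5 := dominates (f + 1) 1 (by omega) (by omega) (by push_cast; ring)
  have g1 := gam_le_sum_size_trace S (f - 2)
  have g2 := gam_le_sum_size_trace S (f - 1)
  have g3 := gam_le_sum_size_trace S (f + 1)
  have hsum := sum_range_add_natCast (fun i => (5 * (trace S i).size - 3 : ℤ)) (f - 2)
  have hcard : ∑ i, (5 * (trace S i).size - 3 : ℤ) = 5 * S.ncard - 3 * (6 + m) := by
    rw [ncard_eq_sum_size_trace, Finset.sum_sub_distrib, ← Finset.mul_sum]
    simp [ZMod.card]
    ring
  rw [hcard, Finset.sum_range_add] at hsum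
  simp only [Finset.sum_range_succ, Finset.sum_range_zero] at hsum
  push_cast [hcast] at hchain hsum
  ring_nf at hchain hsum d1 d2 d3 d4 d5 g1 g2 g3 h2 hclose t0 t1 t3 t4
  simp only [t0, t1, t2, t3, t4] at hchain hsum d1 d2 d3 d4 d5 g1 g2 g3
  simp only [show Trace.none.size = 0 from rfl, show Trace.outer.size = 1 from rfl,
    show Trace.inner.size = 1 from rfl] at hsum g1 g2 g3
  have hclosed := hclose d1 d2 d3 d4 d5 (by omega)
  have hbound : 3 * (6 + m) ≤ 5 * S.ncard := by
    push_cast at hsum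
    omega
  rw [ceil35, Nat.ceil_le, div_le_iff₀ (by norm_num)]
  exact_mod_cast hbound.trans_eq (mul_comm _ _)


end PetersenDom
end

section
/- Let n ≥ 11 with n ≡ 1 (mod 5) or n ≡ 2 (mod 5), and let f ∈ ℤ/nℤ. If there exists a Type II set S for P_f(n,2), then |S| ≤ ⌈3n/5⌉ − 1. -/
namespace PetersenDom

lemma mem_or_adj_uV {n : ℕ} {S : Set (PVert n)} {i : ZMod n}
    (h : uV i ∈ S ∨ vV i ∈ S ∨ uV (i - 1) ∈ S ∨ uV (i + 1) ∈ S) :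
    uV i ∈ S ∨ ∃ x ∈ S, (P2 n).Adj x (uV i) := by
  by_cases hi : uV i ∈ S
  · exact Or.inl hi
  right
  rcases h with h | h | h | h
  · exact absurd h hi
  · exact ⟨_, h, fun e => hi (e ▸ h), Or.inr (Or.inr (Or.inl ⟨i, rfl, rfl⟩))⟩
  · exact ⟨_, h, fun e => hi (e ▸ h), Or.inl (Or.inl ⟨i - 1, rfl, by simp⟩)⟩
  · exact ⟨_, h, fun e => hi (e ▸ h), Or.inr (Or.inl ⟨i, rfl, rfl⟩)⟩

lemma mem_or_adj_vV {n : ℕ} {S : Set (PVert n)} {i : ZMod n}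
    (h : vV i ∈ S ∨ uV i ∈ S ∨ vV (i - 2) ∈ S ∨ vV (i + 2) ∈ S) :
    vV i ∈ S ∨ ∃ x ∈ S, (P2 n).Adj x (vV i) := by
  by_cases hi : vV i ∈ S
  · exact Or.inl hi
  right
  rcases h with h | h | h | h
  · exact absurd h hi
  · exact ⟨_, h, fun e => hi (e ▸ h), Or.inl (Or.inr (Or.inl ⟨i, rfl, rfl⟩))⟩
  · exact ⟨_, h, fun e => hi (e ▸ h), Or.inl (Or.inr (Or.inr ⟨i - 2, rfl, by simp⟩))⟩
  · exact ⟨_, h, fun e => hi (e ▸ h), Or.inr (Or.inr (Or.inr ⟨i, rfl, rfl⟩))⟩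

/-- Offsets, counted from `f - 2`, of the outer vertices of `domConstr`. -/
def outerOffsets (n : ℕ) : Finset ℕ :=
  insert 0 ((Finset.range ((n - 2) / 5)).image (fun m => 5 * m + 6))

/-- Offsets, counted from `f - 2`, of the inner vertices of `domConstr`. -/
def innerOffsets (n : ℕ) : Finset ℕ :=
  (Finset.range (n / 5)).image (fun m => 5 * m + 3) ∪
    (Finset.range (n / 5)).image (fun m => 5 * m + 4)

/-- A small dominating set of `P_f(n,2)` when `n ≡ 1, 2 (mod 5)`. -/
def domConstr (n : ℕ) (f : ZMod n) : Finset (PVert n) :=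
  (outerOffsets n).image (fun j : ℕ => uV (f - 2 + j)) ∪
    (innerOffsets n).image (fun j : ℕ => vV (f - 2 + j))

lemma mem_outerOffsets {n j : ℕ} :
    j ∈ outerOffsets n ↔ j = 0 ∨ 6 ≤ j ∧ j % 5 = 1 ∧ j < n := by
  simp only [outerOffsets, Finset.mem_insert, Finset.mem_image, Finset.mem_range]
  refine or_congr Iff.rfl ⟨?_, fun h => ⟨(j - 6) / 5, by omega, by omega⟩⟩
  rintro ⟨m, hm, rfl⟩
  omega

lemma mem_innerOffsets {n j : ℕ} (hmod : n % 5 = 1 ∨ n % 5 = 2) :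
    j ∈ innerOffsets n ↔ (j % 5 = 3 ∨ j % 5 = 4) ∧ j < n := by
  simp only [innerOffsets, Finset.mem_union, Finset.mem_image, Finset.mem_range]
  constructor
  · rintro (⟨m, hm, rfl⟩ | ⟨m, hm, rfl⟩) <;> omega
  · rintro ⟨h | h, hj⟩
    · exact Or.inl ⟨j / 5, by omega, by omega⟩
    · exact Or.inr ⟨j / 5, by omega, by omega⟩

lemma uV_mem_domConstr {n : ℕ} {f i : ZMod n} :
    uV i ∈ (domConstr n f : Set (PVert n)) ↔ ∃ j ∈ outerOffsets n, f - 2 + (j : ZMod n) = i := by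
  simp [domConstr, uV, vV]

lemma vV_mem_domConstr {n : ℕ} {f i : ZMod n} :
    vV i ∈ (domConstr n f : Set (PVert n)) ↔ ∃ j ∈ innerOffsets n, f - 2 + (j : ZMod n) = i := by
  simp [domConstr, uV, vV]

lemma card_domConstr_le (n : ℕ) (f : ZMod n) :
    (domConstr n f).card ≤ (n - 2) / 5 + 1 + 2 * (n / 5) := by
  have hU : (outerOffsets n).card ≤ (n - 2) / 5 + 1 :=
    (Finset.card_insert_le _ _).trans
      (Nat.succ_le_succ (Finset.card_image_le.trans_eq (Finset.card_range _)))
  have hV : (innerOffsets n).card ≤ n / 5 + n / 5 :=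
    (Finset.card_union_le _ _).trans (Nat.add_le_add
      (Finset.card_image_le.trans_eq (Finset.card_range _))
      (Finset.card_image_le.trans_eq (Finset.card_range _)))
  have h : (domConstr n f).card ≤ (outerOffsets n).card + (innerOffsets n).card :=
    (Finset.card_union_le _ _).trans (Nat.add_le_add Finset.card_image_le Finset.card_image_le)
  omega

lemma isDomSetF_domConstr {n : ℕ} (hn : 5 ≤ n) (hmod : n % 5 = 1 ∨ n % 5 = 2) (f : ZMod n) :
    IsDomSetF n f (domConstr n f) := by
  have : NeZero n := ⟨by omega⟩
  have hcoord (i : ZMod n) : ∃ j < n, f - 2 + (j : ZMod n) = i :=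
    ⟨(i - (f - 2)).val, ZMod.val_lt _, by simp⟩
  refine ⟨?_, ?_⟩
  · rw [uV_mem_domConstr]
    rintro ⟨j, hj, e⟩
    rw [mem_outerOffsets] at hj
    have e2 : (j : ZMod n) = (2 : ℕ) := by
      push_cast
      linear_combination e
    have := congrArg ZMod.val e2
    rw [ZMod.val_natCast_of_lt (by omega), ZMod.val_natCast_of_lt (by omega)] at this
    omega
  rintro (i | i) hi
  · change uV i ∈ _ ∨ ∃ x ∈ _, (P2 n).Adj x (uV i)
    obtain ⟨j, hj, rfl⟩ := hcoord i
    have hj2 : j ≠ 2 := by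
      rintro rfl
      exact hi (congrArg Sum.inl (by push_cast; ring))
    apply mem_or_adj_uV
    simp only [uV_mem_domConstr, vV_mem_domConstr, mem_outerOffsets, mem_innerOffsets hmod]
    by_cases hV : j % 5 = 3 ∨ j % 5 = 4
    · exact Or.inr (Or.inl ⟨j, ⟨hV, hj⟩, rfl⟩)
    by_cases hU : j = 0 ∨ 6 ≤ j ∧ j % 5 = 1 ∧ j < n
    · exact Or.inl ⟨j, hU, rfl⟩
    by_cases hprev : j % 5 = 0
    · refine Or.inr (Or.inr (Or.inr ?_))
      by_cases hlast : j + 1 = n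
      · refine ⟨0, Or.inl rfl, ?_⟩
        have h0 : (j : ZMod n) + 1 = 0 := by
          exact_mod_cast (congrArg (Nat.cast (R := ZMod n)) hlast).trans (ZMod.natCast_self n)
        push_cast
        linear_combination -h0
      · exact ⟨j + 1, Or.inr (by omega), by push_cast; ring⟩
    · refine Or.inr (Or.inr (Or.inl ⟨j - 1, by omega, ?_⟩))
      rw [Nat.cast_sub (by omega)]
      push_cast
      ring
  · change vV i ∈ _ ∨ ∃ x ∈ _, (P2 n).Adj x (vV i)
    obtain ⟨j, hj, rfl⟩ := hcoord i
    apply mem_or_adj_vV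
    simp only [uV_mem_domConstr, vV_mem_domConstr, mem_outerOffsets, mem_innerOffsets hmod]
    by_cases hV : j % 5 = 3 ∨ j % 5 = 4
    · exact Or.inl ⟨j, ⟨hV, hj⟩, rfl⟩
    by_cases hU : j = 0 ∨ 6 ≤ j ∧ j % 5 = 1 ∧ j < n
    · exact Or.inr (Or.inl ⟨j, hU, rfl⟩)
    by_cases hprev : j % 5 = 0
    · refine Or.inr (Or.inr (Or.inl ⟨j - 2, by omega, ?_⟩))
      rw [Nat.cast_sub (by omega)]
      push_cast
      ring
    · exact Or.inr (Or.inr (Or.inr ⟨j + 2, by omega, by push_cast; ring⟩))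

lemma three_mul_le_five_mul_ceil35 (n : ℕ) : 3 * n ≤ 5 * ceil35 n := by
  have h : 3 * (n : ℚ) / 5 ≤ ceil35 n := Nat.le_ceil _
  have hq : (3 * n : ℚ) ≤ 5 * ceil35 n := by linarith
  exact_mod_cast hq

/-- for `n ≡ 1` or `2 (mod 5)`, every Type II set has
cardinality at most `⌈3n/5⌉ - 1`. -/
theorem typeII_upper_bound_mod12 (n : ℕ) (hn : 11 ≤ n)
    (hmod : n % 5 = 1 ∨ n % 5 = 2) (f : ZMod n) (S : Set (PVert n))
    (hS : TypeII n f S) :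
    S.ncard ≤ ceil35 n - 1 := by
  have hT : domNumF n f ≤ (domConstr n f).card :=
    Nat.sInf_le ⟨_, isDomSetF_domConstr (by omega) hmod f, Set.ncard_coe_finset _⟩
  have hcard := card_domConstr_le n f
  have hceil := three_mul_le_five_mul_ceil35 n
  have hmin := hS.1.1.2
  omega

end PetersenDom
end
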